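/- For any graph G with arboricity α(G) and m edges, the sum over all edges {u,v} of min(deg(u), deg(v)) is at most 2·α(G)·m. -/

import Mathlib

def IsForestDecomposition {V : Type*} (G : SimpleGraph V) (a : ℕ) : Prop :=
  ∃ f : Sym2 V → Fin a, ∀ i : Fin a,
    (SimpleGraph.fromEdgeSet {e | e ∈ G.edgeSet ∧ f e = i}).IsAcyclic

noncomputable def arboricity {V : Type*} (G : SimpleGraph V) : ℕ :=
  sInf {a | IsForestDecomposition G a}

lemma forest_parent {V : Type*} (F : SimpleGraph V) (hF : F.IsAcyclic) :
    ∃ g : V → Sym2 V, ∀ e ∈ F.edgeSet, ∃ v ∈ e, g v = e := by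
  classical
  have hr : ∃ r : V → V, (∀ v, F.Reachable (r v) v) ∧ ∀ u v, F.Adj u v → r u = r v := by
    refine ⟨fun v => (F.connectedComponentMk v).out, fun v => ?_, fun u v h => ?_⟩
    · exact SimpleGraph.ConnectedComponent.exact (Quot.out_eq (F.connectedComponentMk v))
    · have : F.connectedComponentMk u = F.connectedComponentMk v :=
        SimpleGraph.ConnectedComponent.sound h.reachable
      simp only [this]
  obtain ⟨r, hr1, hr2⟩ := hr
  have hp : ∀ v, ∃ p : F.Walk (r v) v, p.IsPath := fun v => (hr1 v).exists_isPath
  choose p hp using hp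
  refine ⟨fun v => s((p v).penultimate, v), fun e => ?_⟩
  induction e using Sym2.ind with
  | _ u v =>
    intro h
    have h : F.Adj u v := h
    obtain ⟨q, hq, hqe⟩ : ∃ q : F.Walk (r v) u, q.IsPath ∧ q.penultimate = (p u).penultimate := by
      rw [← hr2 u v h]
      exact ⟨p u, hp u, rfl⟩
    by_cases hu : u ∈ (p v).support
    · refine ⟨v, by simp, ?_⟩
      have := hF.eq_penultimate_of_adj_end (hp v) h.symm hu
      simp only [← this]
    · have hv := hF.mem_support_of_ne_mem_support_of_adj_of_isPath hq (hp v) h hu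
      refine ⟨u, by simp, ?_⟩
      have := hF.eq_penultimate_of_adj_end hq h hv
      simp only [← hqe, ← this]
      exact Sym2.eq_swap

theorem sum_min_degree_le_arboricity {V : Type*} [Fintype V] [DecidableEq V]
    (G : SimpleGraph V) [DecidableRel G.Adj]
    (hdecomp : IsForestDecomposition G (arboricity G)) :
    ∑ e ∈ G.edgeFinset,
        Sym2.lift ⟨fun u v => min (G.degree u) (G.degree v),
          fun a b => min_comm _ _⟩ e
      ≤ 2 * arboricity G * G.edgeFinset.card := by
  obtain ⟨f, hf⟩ := hdecomp
  rw [← Finset.sum_fiberwise (s := G.edgeFinset) (g := f)]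
  have key : ∀ i, ∑ e ∈ G.edgeFinset with f e = i,
      Sym2.lift ⟨fun u v => min (G.degree u) (G.degree v), fun a b => min_comm _ _⟩ e
      ≤ 2 * G.edgeFinset.card := by
    intro i
    obtain ⟨g, hg⟩ := forest_parent _ (hf i)
    have hg' : ∀ e : Sym2 V, ∃ v, e ∈ G.edgeFinset.filter (fun e => f e = i) →
        v ∈ e ∧ g v = e := by
      intro e
      by_cases he : e ∈ G.edgeFinset.filter (fun e => f e = i)
      · have he' : e ∈ G.edgeSet ∧ f e = i := by simpa using he
        obtain ⟨v, hv⟩ := hg e (by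
          rw [SimpleGraph.edgeSet_fromEdgeSet]
          exact ⟨he', G.not_isDiag_of_mem_edgeSet he'.1⟩)
        exact ⟨v, fun _ => hv⟩
      · induction e using Sym2.ind with
        | _ u v => exact ⟨u, fun h => absurd h he⟩
    choose k hk using hg'
    rw [← G.sum_degrees_eq_twice_card_edges]
    calc _ ≤ ∑ e ∈ G.edgeFinset with f e = i, G.degree (k e) := by
          refine Finset.sum_le_sum fun e he => ?_
          have h1 := (hk e he).1
          generalize k e = w at h1
          induction e using Sym2.ind with
          | _ u v =>
            rcases Sym2.mem_iff.1 h1 with rfl | rfl <;> simp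
      _ = ∑ v ∈ (G.edgeFinset.filter (fun e => f e = i)).image k, G.degree v := by
          rw [Finset.sum_image]
          intro a ha b hb hab
          rw [← (hk a ha).2, ← (hk b hb).2, hab]
      _ ≤ _ := Finset.sum_le_sum_of_subset (Finset.subset_univ _)
  calc _ ≤ ∑ _i : Fin (arboricity G), 2 * G.edgeFinset.card := Finset.sum_le_sum fun i _ => key i
    _ = _ := by simp; ring
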